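/- Let k ≥ 3, let t₁, t₂, t₃ be nonnegative integers with 2t₁ + t₂ + t₃ + k + 2 = n, where n ≥ 4k. Then ρ(K_1(t₁, t₂, t₃)) < ρ(K_1(t₁, t₂ + t₃ + 2, 0)). -/

import Mathlib

open SimpleGraph

/-- The `l`-edge-connectivity of a graph: the minimum number of edges whose removal
leaves a graph with at least `l` connected components, if the graph has at least `l`
vertices; otherwise the number of vertices. -/
noncomputable def edgeConnL {V : Type*} (l : ℕ) (G : SimpleGraph V) : ℕ :=
  if l ≤ Nat.card V then
    sInf {c : ℕ | ∃ F : Set (Sym2 V), F ⊆ G.edgeSet ∧ F.ncard = c ∧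
      l ≤ Nat.card (G.deleteEdges F).ConnectedComponent}
  else Nat.card V

/-- A graph is minimally `(k,l)`-edge-connected if it is connected, its
`l`-edge-connectivity is at least `k`, and deleting any edge drops the
`l`-edge-connectivity below `k`. -/
def IsMinimallyKLEdgeConnected {V : Type*} (k l : ℕ) (G : SimpleGraph V) : Prop :=
  G.Connected ∧ k ≤ edgeConnL l G ∧
    ∀ e ∈ G.edgeSet, edgeConnL l (G.deleteEdges {e}) < k

/-- The real adjacency matrix of a simple graph. -/
noncomputable def adjMat {V : Type*} (G : SimpleGraph V) : Matrix V V ℝ :=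
  letI := Classical.decRel G.Adj
  G.adjMatrix ℝ

/-- The spectral radius of a graph: the largest (real) eigenvalue of its adjacency matrix. -/
noncomputable def specRad {V : Type*} [Fintype V] [DecidableEq V]
    (G : SimpleGraph V) : ℝ :=
  sSup (spectrum ℝ (adjMat G))

abbrev K1V (k t₁ t₂ t₃ : ℕ) : Type :=
  Unit ⊕ ((Fin t₁ × Fin 2) ⊕ (Fin (if t₂ = 0 then 0 else t₂ + 1) ⊕
    (Fin (if t₃ = 0 then 0 else t₃ + 2) ⊕ Fin (k - 2))))

/-- `K_1(t₁, t₂, t₃)` (with `k - 2` pendant edges): the graph obtained from the disjoint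
union of the friendship graph with `t₁` triangles (apex `u₁`), the complete bipartite graph
`K_{2,t₂}` (with `u₂` a vertex of maximum degree, i.e. in the part of size two), the complete
bipartite graph `K_{2,t₃+1}` (with `u₃` a vertex of degree 2, i.e. in the part of size
`t₃ + 1`), and the star `K_{1,k-2}` (centre `u₄`), by identifying `u₁, u₂, u₃, u₄` into a
single vertex `u*`.  Here `Sum.inl _` is `u*`; `Fin t₁ × Fin 2` are the outer triangle
vertices; in the third summand index `0` is the second vertex `v` of the part of size two of
`K_{2,t₂}` and indices `1, …, t₂` form the part of size `t₂` (this part is empty when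
`t₂ = 0`); in the fourth summand indices `0, 1` are the two vertices `w₁', w₂'` of the part
of size two of `K_{2,t₃+1}` and indices `2, …, t₃ + 1` are the remaining vertices of the
part of size `t₃ + 1` besides `u*` (this part is empty when `t₃ = 0`); the last summand
consists of the `k - 2` pendant vertices. -/
def K1Graph (k t₁ t₂ t₃ : ℕ) : SimpleGraph (K1V k t₁ t₂ t₃) :=
  SimpleGraph.fromRel (fun a b =>
    match a, b with
    | Sum.inl _, Sum.inr (Sum.inl _) => True
    | Sum.inl _, Sum.inr (Sum.inr (Sum.inl j)) => 1 ≤ j.val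
    | Sum.inl _, Sum.inr (Sum.inr (Sum.inr (Sum.inl j))) => j.val < 2
    | Sum.inl _, Sum.inr (Sum.inr (Sum.inr (Sum.inr _))) => True
    | Sum.inr (Sum.inl (i, _)), Sum.inr (Sum.inl (j, _)) => i = j
    | Sum.inr (Sum.inr (Sum.inl j)), Sum.inr (Sum.inr (Sum.inl j')) => j.val = 0 ∧ 1 ≤ j'.val
    | Sum.inr (Sum.inr (Sum.inr (Sum.inl j))), Sum.inr (Sum.inr (Sum.inr (Sum.inl j'))) =>
        j.val < 2 ∧ 2 ≤ j'.val
    | _, _ => False)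

/-- `K(t₁, t₂)` (with `k - 2` pendant edges): the graph obtained from the disjoint union of
the friendship graph with `t₁` triangles, the complete bipartite graph `K_{2,t₂}` and the
star `K_{1,k-2}` by identifying the apex, a maximum degree vertex of `K_{2,t₂}` and the
centre of the star into a single vertex; this is `K_1(t₁, t₂, 0)`. -/
def KGraph (k t₁ t₂ : ℕ) : SimpleGraph (K1V k t₁ t₂ 0) := K1Graph k t₁ t₂ 0

open Matrix in
lemma adjMat_mulVec_apply {V : Type*} [Fintype V] (G : SimpleGraph V) [DecidableRel G.Adj]
    (x : V → ℝ) (i : V) :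
    (adjMat G *ᵥ x) i = ∑ j, if G.Adj i j then x j else 0 := by
  simp only [adjMat, Matrix.mulVec, dotProduct, SimpleGraph.adjMatrix_apply, ite_mul, one_mul,
    zero_mul]

lemma adjMat_isHermitian {V : Type*} (G : SimpleGraph V) : (adjMat G).IsHermitian := by
  classical
  ext i j
  simp [adjMat, SimpleGraph.adjMatrix_apply, G.adj_comm]

lemma bddAbove_spectrum_adjMat {V : Type*} [Fintype V] [DecidableEq V] (G : SimpleGraph V) :
    BddAbove (spectrum ℝ (adjMat G)) :=
  (Matrix.finite_spectrum (adjMat G)).bddAbove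

open Matrix in
/-- The Rayleigh bound: the quadratic form of the adjacency matrix is at most the spectral
radius times the squared Euclidean norm. -/
lemma dotProduct_adjMat_mulVec_le {V : Type*} [Fintype V] [DecidableEq V] (G : SimpleGraph V)
    (y : V → ℝ) : y ⬝ᵥ (adjMat G *ᵥ y) ≤ specRad G * (y ⬝ᵥ y) := by
  have hpsd : (algebraMap ℝ (Matrix V V ℝ) (specRad G) - adjMat G).PosSemidef := by
    rw [Matrix.posSemidef_iff_isHermitian_and_spectrum_nonneg]
    refine ⟨?_, ?_⟩
    · refine Matrix.IsHermitian.sub ?_ (adjMat_isHermitian G)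
      rw [Matrix.algebraMap_eq_diagonal]
      exact Matrix.isHermitian_diagonal _
    · rw [← spectrum.singleton_sub_eq]
      rintro _ ⟨_, rfl, μ, hμ, rfl⟩
      exact sub_nonneg.2 (le_csSup (bddAbove_spectrum_adjMat G) hμ)
  have h := hpsd.dotProduct_mulVec_nonneg y
  simp [Matrix.sub_mulVec, Algebra.algebraMap_eq_smul_one, Matrix.smul_mulVec, dotProduct_sub] at h
  exact h

open Matrix in
/-- The Collatz–Wielandt upper bound. -/
lemma specRad_le_of_mulVec_le {V : Type*} [Fintype V] [DecidableEq V] [Nonempty V]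
    (G : SimpleGraph V) (x : V → ℝ) (r : ℝ) (hx : ∀ i, 0 < x i)
    (h : ∀ i, (adjMat G *ᵥ x) i ≤ r * x i) : specRad G ≤ r := by
  classical
  refine csSup_le ⟨_, (adjMat_isHermitian G).eigenvalues_mem_spectrum_real
    (Classical.arbitrary V)⟩ fun μ hμ => ?_
  rw [← Matrix.spectrum_toLin', ← Module.End.hasEigenvalue_iff_mem_spectrum] at hμ
  obtain ⟨v, hv⟩ := hμ.exists_hasEigenvector
  have hAv : adjMat G *ᵥ v = μ • v := by simpa using hv.apply_eq_smul
  obtain ⟨i, hi⟩ := Finite.exists_max fun j => |v j| / x j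
  have hbound : ∀ j, |v j| ≤ |v i| / x i * x j := fun j => (div_le_iff₀ (hx j)).1 (hi j)
  have hvi : 0 < |v i| := by
    by_contra! h0
    refine hv.2 (funext fun j => ?_)
    have := hbound j
    rw [le_antisymm h0 (abs_nonneg _)] at this
    simpa using this
  have hsum : μ * |v i| ≤ r * |v i| := by
    calc μ * |v i| ≤ |μ * v i| := by
          rw [abs_mul]; exact mul_le_mul_of_nonneg_right (le_abs_self _) (abs_nonneg _)
      _ = |∑ j, if G.Adj i j then v j else 0| := by
          rw [← adjMat_mulVec_apply, hAv, Pi.smul_apply, smul_eq_mul]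
      _ ≤ ∑ j, |v i| / x i * (if G.Adj i j then x j else 0) := by
          refine (Finset.abs_sum_le_sum_abs _ _).trans (Finset.sum_le_sum fun j _ => ?_)
          split_ifs
          · exact hbound j
          · simp
      _ = |v i| / x i * (adjMat G *ᵥ x) i := by
          rw [adjMat_mulVec_apply, Finset.mul_sum]
      _ ≤ |v i| / x i * (r * x i) :=
          mul_le_mul_of_nonneg_left (h i) (div_nonneg (abs_nonneg _) (hx i).le)
      _ = r * |v i| := by field_simp [(hx i).ne']
  exact le_of_mul_le_mul_right hsum hvi

open Matrix in
lemma le_specRad_of_le_mulVec {V : Type*} [Fintype V] [DecidableEq V] (G : SimpleGraph V)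
    (y : V → ℝ) (r : ℝ) (hy : ∀ i, 0 ≤ y i) (hpos : ∃ i, 0 < y i)
    (h : ∀ i, r * y i ≤ (adjMat G *ᵥ y) i) : r ≤ specRad G := by
  obtain ⟨i, hi⟩ := hpos
  have hyy : 0 < y ⬝ᵥ y :=
    Finset.sum_pos' (fun j _ => mul_self_nonneg _) ⟨i, Finset.mem_univ i, mul_pos hi hi⟩
  refine le_of_mul_le_mul_right (le_trans ?_ (dotProduct_adjMat_mulVec_le G y)) hyy
  simp only [dotProduct, Finset.mul_sum]
  exact Finset.sum_le_sum fun j _ => by nlinarith [mul_le_mul_of_nonneg_left (h j) (hy j)]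

open Matrix in
lemma lt_specRad_of_le_mulVec {V : Type*} [Fintype V] [DecidableEq V] (G : SimpleGraph V)
    (y : V → ℝ) (r : ℝ) (hy : ∀ i, 0 ≤ y i) (h : ∀ i, r * y i ≤ (adjMat G *ᵥ y) i)
    (hlt : ∃ i, 0 < y i ∧ r * y i < (adjMat G *ᵥ y) i) : r < specRad G := by
  obtain ⟨i, hi, hri⟩ := hlt
  have hyy : 0 < y ⬝ᵥ y :=
    Finset.sum_pos' (fun j _ => mul_self_nonneg _) ⟨i, Finset.mem_univ i, mul_pos hi hi⟩
  refine lt_of_mul_lt_mul_right (lt_of_lt_of_le ?_ (dotProduct_adjMat_mulVec_le G y)) hyy.le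
  simp only [dotProduct, Finset.mul_sum]
  exact Finset.sum_lt_sum (fun j _ => by nlinarith [mul_le_mul_of_nonneg_left (h j) (hy j)])
    ⟨i, Finset.mem_univ i, by nlinarith [mul_lt_mul_of_pos_left hri hi]⟩

/-- A vector constant on the natural vertex classes of `K1Graph`. -/
def K1vec {k t₁ t₂ t₃ : ℕ} (a b c₀ c₁ d₀ d₁ e : ℝ) : K1V k t₁ t₂ t₃ → ℝ
  | Sum.inl _ => a
  | Sum.inr (Sum.inl _) => b
  | Sum.inr (Sum.inr (Sum.inl j)) => if j.val = 0 then c₀ else c₁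
  | Sum.inr (Sum.inr (Sum.inr (Sum.inl j))) => if j.val < 2 then d₀ else d₁
  | Sum.inr (Sum.inr (Sum.inr (Sum.inr _))) => e

lemma sum_fin_ite_add_one (t : ℕ) (f : ℕ → ℝ) :
    ∑ x : Fin (if t = 0 then 0 else t + 1), f x =
      if t = 0 then 0 else f 0 + ∑ i ∈ Finset.range t, f (i + 1) := by
  rw [Fin.sum_univ_eq_sum_range]
  split_ifs
  · simp
  · rw [Finset.sum_range_succ', add_comm]

lemma sum_fin_ite_add_two (t : ℕ) (f : ℕ → ℝ) :
    ∑ x : Fin (if t = 0 then 0 else t + 2), f x =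
      if t = 0 then 0 else f 0 + f 1 + ∑ i ∈ Finset.range t, f (i + 2) := by
  rw [Fin.sum_univ_eq_sum_range]
  split_ifs
  · simp
  · rw [Finset.sum_range_succ', Finset.sum_range_succ']
    ring

section mulVec

open Matrix

variable {k t₁ t₂ t₃ : ℕ} (a b c₀ c₁ d₀ d₁ e : ℝ)

lemma K1Graph_mulVec_center (u : Unit) :
    (adjMat (K1Graph k t₁ t₂ t₃) *ᵥ K1vec a b c₀ c₁ d₀ d₁ e) (Sum.inl u) =
      2 * t₁ * b + t₂ * c₁ + (if t₃ = 0 then 0 else 2 * d₀) + (k - 2 : ℕ) * e := by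
  classical
  rw [adjMat_mulVec_apply]
  simp [Fintype.sum_sum_type, K1Graph, K1vec]
  rw [sum_fin_ite_add_one t₂ fun x => if 1 ≤ x then if x = 0 then c₀ else c₁ else 0,
    sum_fin_ite_add_two t₃ fun x => if x ≤ 1 then if x ≤ 1 then d₀ else d₁ else 0]
  by_cases h₂ : t₂ = 0 <;> by_cases h₃ : t₃ = 0 <;>
    simp [h₂, h₃, -mul_eq_mul_right_iff] <;> ring

lemma K1Graph_mulVec_triangle (p : Fin t₁ × Fin 2) :
    (adjMat (K1Graph k t₁ t₂ t₃) *ᵥ K1vec a b c₀ c₁ d₀ d₁ e) (Sum.inr (Sum.inl p)) = a + b := by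
  classical
  obtain ⟨i, j⟩ := p
  rw [adjMat_mulVec_apply]
  simp [Fintype.sum_sum_type, K1Graph, K1vec, Fintype.sum_prod_type]
  rw [Finset.sum_eq_single i]
  · fin_cases j <;> simp
  · intro x _ hx
    simp [hx, hx.symm]
  · simp

lemma K1Graph_mulVec_bipartite (j : Fin (if t₂ = 0 then 0 else t₂ + 1)) :
    (adjMat (K1Graph k t₁ t₂ t₃) *ᵥ K1vec a b c₀ c₁ d₀ d₁ e) (Sum.inr (Sum.inr (Sum.inl j))) =
      if j.val = 0 then t₂ * c₁ else a + c₀ := by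
  classical
  rw [adjMat_mulVec_apply]
  simp [Fintype.sum_sum_type, K1Graph, K1vec]
  have h₂ : t₂ ≠ 0 := by
    rintro rfl
    exact absurd j.isLt (by simp)
  simp only [Fin.ext_iff]
  obtain ⟨j, hj⟩ := j
  rw [sum_fin_ite_add_one t₂ fun x =>
    if ¬j = x ∧ (j = 0 ∧ 1 ≤ x ∨ x = 0 ∧ 1 ≤ j) then if x = 0 then c₀ else c₁ else 0]
  rcases Nat.eq_zero_or_pos j with rfl | hj0
  · simp [h₂]
  · simp [h₂, hj0.ne', Nat.one_le_iff_ne_zero]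

lemma K1Graph_mulVec_bipartite' (j : Fin (if t₃ = 0 then 0 else t₃ + 2)) :
    (adjMat (K1Graph k t₁ t₂ t₃) *ᵥ K1vec a b c₀ c₁ d₀ d₁ e)
      (Sum.inr (Sum.inr (Sum.inr (Sum.inl j)))) =
      if j.val < 2 then a + t₃ * d₁ else 2 * d₀ := by
  classical
  rw [adjMat_mulVec_apply]
  simp [Fintype.sum_sum_type, K1Graph, K1vec]
  have h₃ : t₃ ≠ 0 := by
    rintro rfl
    exact absurd j.isLt (by simp)
  simp only [Fin.ext_iff]
  obtain ⟨j, hj⟩ := j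
  rw [sum_fin_ite_add_two t₃ fun x =>
    if ¬j = x ∧ (j ≤ 1 ∧ 2 ≤ x ∨ x ≤ 1 ∧ 2 ≤ j) then if x ≤ 1 then d₀ else d₁ else 0]
  rcases le_or_gt j 1 with hj1 | hj1
  · have hne : ∀ i, j ≠ i + 2 := by omega
    have hj2 : ¬2 ≤ j := by omega
    simp [h₃, hj1, hj2, hne]
  · have h₀ : j ≠ 0 := by omega
    have h₁ : j ≠ 1 := by omega
    have h₄ : 2 ≤ j := hj1
    simp [h₃, hj1.not_ge, h₀, h₁, h₄]
    ring

lemma K1Graph_mulVec_pendant (j : Fin (k - 2)) :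
    (adjMat (K1Graph k t₁ t₂ t₃) *ᵥ K1vec a b c₀ c₁ d₀ d₁ e)
      (Sum.inr (Sum.inr (Sum.inr (Sum.inr j)))) = a := by
  classical
  rw [adjMat_mulVec_apply]
  simp [Fintype.sum_sum_type, K1Graph, K1vec]

end mulVec

lemma specRad_K1Graph_le {k t₁ t₂ t₃ : ℕ} {r : ℝ} (hr : 1 < r) (h₂ : (t₂ : ℝ) < r ^ 2)
    (h₃ : 2 * (t₃ : ℝ) < r ^ 2)
    (h : 2 * t₁ / (r - 1) + t₂ * r / (r ^ 2 - t₂) + 2 * r / (r ^ 2 - 2 * t₃) + (k - 2 : ℕ) / r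
      ≤ r) :
    specRad (K1Graph k t₁ t₂ t₃) ≤ r := by
  have hr0 : 0 < r := by linarith
  have hr1 : 0 < r - 1 := by linarith
  have hd₂ : 0 < r ^ 2 - t₂ := by linarith
  have hd₃ : 0 < r ^ 2 - 2 * t₃ := by linarith
  refine specRad_le_of_mulVec_le _ (K1vec 1 (1 / (r - 1)) (t₂ / (r ^ 2 - t₂)) (r / (r ^ 2 - t₂))
    (r / (r ^ 2 - 2 * t₃)) (2 / (r ^ 2 - 2 * t₃)) (1 / r)) r ?_ ?_
  · rintro (_ | _ | j | j | _) <;> simp only [K1vec]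
    · exact one_pos
    · positivity
    · have : 0 < t₂ := Nat.pos_of_ne_zero (by rintro rfl; exact absurd j.isLt (by simp))
      split_ifs <;> positivity
    · split_ifs <;> positivity
    · positivity
  · rintro (_ | _ | j | j | _)
    · rw [K1Graph_mulVec_center]
      simp only [K1vec]
      have hpos : 0 ≤ 2 * (r / (r ^ 2 - 2 * t₃)) := by positivity
      have hite : (if t₃ = 0 then 0 else 2 * (r / (r ^ 2 - 2 * t₃))) ≤
          2 * (r / (r ^ 2 - 2 * t₃)) := by split_ifs <;> simp [hpos]
      rw [mul_one]
      refine le_trans ?_ h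
      simp only [mul_one_div, mul_div_assoc] at hite ⊢
      linarith
    · rw [K1Graph_mulVec_triangle]
      simp only [K1vec]
      apply le_of_eq
      field_simp
      ring
    · rw [K1Graph_mulVec_bipartite]
      simp only [K1vec]
      apply le_of_eq
      by_cases hj : j.val = 0 <;>
        simp only [hj, if_true, if_false] <;> field_simp
      ring
    · rw [K1Graph_mulVec_bipartite']
      simp only [K1vec]
      apply le_of_eq
      have hd₃' : r ^ 2 - t₃ * 2 ≠ 0 := by linarith
      by_cases hj : j.val < 2 <;>
        simp only [hj, if_true, if_false] <;> field_simp
      ring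
    · rw [K1Graph_mulVec_pendant]
      simp only [K1vec]
      apply le_of_eq
      field_simp

lemma lt_specRad_K1Graph {k t₁ s : ℕ} {r : ℝ} (hr : 1 < r) (hs : (s : ℝ) < r ^ 2)
    (h : r < 2 * t₁ / (r - 1) + s * r / (r ^ 2 - s) + (k - 2 : ℕ) / r) :
    r < specRad (K1Graph k t₁ s 0) := by
  have hr0 : 0 < r := by linarith
  have hr1 : 0 < r - 1 := by linarith
  have hd : 0 < r ^ 2 - s := by linarith
  have hcenter : r * 1 < 2 * t₁ * (1 / (r - 1)) + s * (r / (r ^ 2 - s)) +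
      (if 0 = 0 then 0 else 2 * 0) + (k - 2 : ℕ) * (1 / r) := by
    simp only [mul_one_div, mul_div_assoc, if_true] at h ⊢
    linarith
  refine lt_specRad_of_le_mulVec _ (K1vec 1 (1 / (r - 1)) (s / (r ^ 2 - s)) (r / (r ^ 2 - s))
    0 0 (1 / r)) r ?_ ?_ ⟨Sum.inl (), one_pos, ?_⟩
  · rintro (_ | _ | j | j | _) <;> simp only [K1vec] <;> (try split_ifs) <;> positivity
  · rintro (_ | _ | j | j | _)
    · rw [K1Graph_mulVec_center]
      exact hcenter.le
    · rw [K1Graph_mulVec_triangle]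
      simp only [K1vec]
      apply le_of_eq
      field_simp
      ring
    · rw [K1Graph_mulVec_bipartite]
      simp only [K1vec]
      apply le_of_eq
      by_cases hj : j.val = 0 <;>
        simp only [hj, if_true, if_false] <;> field_simp
      ring
    · exact absurd j.isLt (by simp)
    · rw [K1Graph_mulVec_pendant]
      simp only [K1vec]
      apply le_of_eq
      field_simp
  · rw [K1Graph_mulVec_center]
    exact hcenter

/-- The graph contains `K_{2,s}`, whose spectral radius is `√(2s)`. -/
lemma sqrt_le_specRad_K1Graph {k t₁ s : ℕ} (hs : s ≠ 0) :
    √(2 * s) ≤ specRad (K1Graph k t₁ s 0) := by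
  have hsq : √(2 * s) * √(2 * s) = 2 * (s : ℝ) := Real.mul_self_sqrt (by positivity)
  have hpos : 0 < √(2 * (s : ℝ)) := by positivity
  refine le_specRad_of_le_mulVec _ (K1vec √(2 * s) 0 √(2 * s) 2 0 0 0) _ ?_
    ⟨Sum.inl (), hpos⟩ ?_
  · rintro (_ | _ | j | j | _) <;> simp only [K1vec] <;> (try split_ifs) <;> positivity
  · rintro (_ | _ | j | j | _)
    · rw [K1Graph_mulVec_center]
      simp only [K1vec, if_true]
      linarith
    · rw [K1Graph_mulVec_triangle]
      simp only [K1vec]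
      linarith
    · rw [K1Graph_mulVec_bipartite]
      simp only [K1vec]
      by_cases hj : j.val = 0 <;> simp only [hj, if_true, if_false] <;> linarith
    · exact absurd j.isLt (by simp)
    · rw [K1Graph_mulVec_pendant]
      simp only [K1vec]
      linarith

/-- If `r` strictly dominates the equitable quotient equation of `K_1(t₁, t₂, t₃)`, then the
spectral radius is strictly below `r`. -/
lemma specRad_K1Graph_lt {k t₁ t₂ t₃ : ℕ} {r : ℝ} (hr : 1 < r) (h₂ : (t₂ : ℝ) < r ^ 2)
    (h₃ : 2 * (t₃ : ℝ) < r ^ 2)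
    (h : 2 * t₁ / (r - 1) + t₂ * r / (r ^ 2 - t₂) + 2 * r / (r ^ 2 - 2 * t₃) + (k - 2 : ℕ) / r
      < r) :
    specRad (K1Graph k t₁ t₂ t₃) < r := by
  have hcont : ContinuousAt (fun x : ℝ => 2 * t₁ / (x - 1) + t₂ * x / (x ^ 2 - t₂) +
      2 * x / (x ^ 2 - 2 * t₃) + (k - 2 : ℕ) / x) r := by
    have h1 : r - 1 ≠ 0 := by linarith
    have h2 : r ^ 2 - t₂ ≠ 0 := by linarith
    have h3 : r ^ 2 - 2 * t₃ ≠ 0 := by linarith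
    have h4 : r ≠ 0 := by linarith
    fun_prop (disch := assumption)
  have hsq : ContinuousAt (fun x : ℝ => x ^ 2) r := by fun_prop
  have hev : ∀ᶠ x in nhdsWithin r (Set.Iio r), specRad (K1Graph k t₁ t₂ t₃) ≤ x := by
    refine Filter.Eventually.filter_mono nhdsWithin_le_nhds ?_
    filter_upwards [hcont.eventually_lt continuousAt_id h, eventually_gt_nhds hr,
      hsq.eventually_const_lt h₂, hsq.eventually_const_lt h₃] with x hx hx1 hx2 hx3
    exact specRad_K1Graph_le hx1 hx2 hx3 hx.le
  obtain ⟨x, hx, hxr⟩ := (hev.and self_mem_nhdsWithin).exists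
  exact hx.trans_lt hxr

/-- Let `k ≥ 3` and let `t₁, t₂, t₃` be nonnegative integers with
`2t₁ + t₂ + t₃ + k + 2 = n`, where `n ≥ 4k`.  Then
`ρ(K_1(t₁, t₂, t₃)) < ρ(K_1(t₁, t₂ + t₃ + 2, 0))`. -/
theorem spectral_radius_K1_lt (k n t₁ t₂ t₃ : ℕ) (hk : 3 ≤ k)
    (hsum : 2 * t₁ + t₂ + t₃ + k + 2 = n) (hn : 4 * k ≤ n) :
    specRad (K1Graph k t₁ t₂ t₃) < specRad (K1Graph k t₁ (t₂ + t₃ + 2) 0) := by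
  have hsq : 2 * ((t₂ + t₃ + 2 : ℕ) : ℝ) ≤ specRad (K1Graph k t₁ (t₂ + t₃ + 2) 0) ^ 2 :=
    (Real.sqrt_le_iff.1 (sqrt_le_specRad_K1Graph (by omega))).2
  have hnonneg : 0 ≤ specRad (K1Graph k t₁ (t₂ + t₃ + 2) 0) :=
    (Real.sqrt_nonneg _).trans (sqrt_le_specRad_K1Graph (by omega))
  have hupper := fun h₁ h₂ => mt (lt_specRad_K1Graph (k := k) (t₁ := t₁) (s := t₂ + t₃ + 2)
    (r := specRad (K1Graph k t₁ (t₂ + t₃ + 2) 0)) h₁ h₂) (lt_irrefl _)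
  generalize specRad (K1Graph k t₁ (t₂ + t₃ + 2) 0) = ρ at *
  push_cast at hsq hupper
  have ht₂ : (0 : ℝ) ≤ t₂ := t₂.cast_nonneg
  have ht₃ : (0 : ℝ) ≤ t₃ := t₃.cast_nonneg
  have hρ : 1 < ρ := by nlinarith
  have hf := not_lt.1 (hupper hρ (by linarith))
  refine specRad_K1Graph_lt hρ (by linarith) (by linarith) (lt_of_lt_of_le ?_ hf)
  have hd : 0 < ρ ^ 2 - (t₂ + t₃ + 2) := by linarith
  have hd₂ : 0 < ρ ^ 2 - t₂ := by linarith
  have hd₃ : 0 < ρ ^ 2 - 2 * t₃ := by linarith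
  have hmid : (t₂ : ℝ) * ρ / (ρ ^ 2 - t₂) ≤ t₂ * ρ / (ρ ^ 2 - (t₂ + t₃ + 2)) :=
    div_le_div_of_nonneg_left (by positivity) hd (by linarith)
  have hout : 2 * ρ / (ρ ^ 2 - 2 * t₃) < (t₃ + 2) * ρ / (ρ ^ 2 - (t₂ + t₃ + 2)) := by
    rw [div_lt_div_iff₀ hd₃ hd]
    have hkey : 2 * (ρ ^ 2 - (t₂ + t₃ + 2)) < (t₃ + 2) * (ρ ^ 2 - 2 * t₃) := by
      nlinarith [mul_nonneg ht₃ (sub_nonneg.2 hsq), mul_nonneg ht₃ ht₂]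
    nlinarith [mul_lt_mul_of_pos_left hkey (zero_lt_one.trans hρ)]
  have hsplit : ((t₂ : ℝ) + t₃ + 2) * ρ / (ρ ^ 2 - (t₂ + t₃ + 2)) =
      t₂ * ρ / (ρ ^ 2 - (t₂ + t₃ + 2)) + (t₃ + 2) * ρ / (ρ ^ 2 - (t₂ + t₃ + 2)) := by ring
  rw [hsplit]
  linarith
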